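/- arXiv:2102.03349 — 3 statements merged into one kernel-verified Lean document; each statement's English description precedes it below -/
import Mathlib

section
/- Let μ be a probability measure on an instance space 𝒳, and let f₁, f₂ : 𝒳 → Δ_K be measurable maps into the probability simplex over K classes such that for μ-almost every x both f₁(x) and f₂(x) have a unique largest coordinate. Let ŷ₁(x), ŷ₂(x) denote the argmax predictions and γ_{x;1}, γ_{x;2} the corresponding prediction confidences. Then μ[{x : ŷ₁(x) ≠ ŷ₂(x)}] ≤ μ[{x : D_{L1}(f₁(x), f₂(x)) > min(γ_{x;1}, γ_{x;2})}]. -/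
open MeasureTheory

/-- The second-largest value of `p` relative to index `i`: the maximum of `p j`
over all `j ≠ i` (well-defined when `1 < K`). -/
noncomputable def sndMax {K : ℕ} (hK : 1 < K) (p : Fin K → ℝ) (i : Fin K) : ℝ :=
  (Finset.univ.erase i).sup'
    (by
      rw [← Finset.card_pos, Finset.card_erase_of_mem (Finset.mem_univ i),
        Finset.card_univ, Fintype.card_fin]
      omega) p

/-- The second-largest value bounds every coordinate other than `i`. -/
theorem le_sndMax {K : ℕ} (hK : 1 < K) (p : Fin K → ℝ) {i j : Fin K} (hji : j ≠ i) :
    p j ≤ sndMax hK p i :=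
  Finset.le_sup' p (Finset.mem_erase.2 ⟨hji, Finset.mem_univ j⟩)

/-- The second-largest value lies strictly below a unique largest coordinate. -/
theorem sndMax_lt {K : ℕ} (hK : 1 < K) {p : Fin K → ℝ} {i : Fin K}
    (h : ∀ j, j ≠ i → p j < p i) : sndMax hK p i < p i :=
  (Finset.sup'_lt_iff _).2 fun j hj => h j (Finset.ne_of_mem_erase hj)

/-- If `q` has its unique largest coordinate at `b` and `a ≠ b`, then the `L1` distance from
`p` to `q` exceeds the smaller of the gaps of `p` at `a` and of `q` at `b`. -/
theorem min_confidence_lt_l1 {K : ℕ} (hK : 1 < K) {p q : Fin K → ℝ} {a b : Fin K}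
    (hab : a ≠ b) (hq : ∀ j, j ≠ b → q j < q b) :
    min (p a - sndMax hK p a) (q b - sndMax hK q b) < ∑ j, |p j - q j| := by
  have hsum : |p a - q a| + |p b - q b| ≤ ∑ j, |p j - q j| := by
    rw [← Finset.sum_pair (f := fun j => |p j - q j|) hab]
    exact Finset.sum_le_sum_of_subset_of_nonneg (Finset.subset_univ _)
      fun j _ _ => abs_nonneg _
  refine (min_le_left _ _).trans_lt ?_
  linarith [le_sndMax hK p hab.symm, le_sndMax hK q hab, sndMax_lt hK hq,
    le_abs_self (p a - q a), neg_abs_le (p b - q b)]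

/-- **Lemma 2.2.** Let `μ` be a probability measure on the instance space `𝒳`, and let
`f₁ f₂ : 𝒳 → Δ_K` be measurable maps into the probability simplex over `K` classes such
that for `μ`-almost every `x` both `f₁ x` and `f₂ x` have a unique largest coordinate
(at `y₁ x` and `y₂ x` respectively).  Then the churn `μ {x | y₁ x ≠ y₂ x}` is at most
`μ {x | D_L1(f₁ x, f₂ x) > min γ_{x;1} γ_{x;2}}`, where `γ_{x;i}` is the prediction
confidence (gap between largest and second-largest coordinates) of `fᵢ x`. -/
theorem churn_le_measure_l1_gt_confidence
    {𝒳 : Type*} [MeasurableSpace 𝒳] (μ : Measure 𝒳) [IsProbabilityMeasure μ]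
    {K : ℕ} (hK : 1 < K)
    (f₁ f₂ : 𝒳 → (Fin K → ℝ))
    (hf₁ : Measurable f₁) (hf₂ : Measurable f₂)
    (hf₁0 : ∀ x j, 0 ≤ f₁ x j) (hf₂0 : ∀ x j, 0 ≤ f₂ x j)
    (hf₁s : ∀ x, ∑ j, f₁ x j = 1) (hf₂s : ∀ x, ∑ j, f₂ x j = 1)
    (y₁ y₂ : 𝒳 → Fin K)
    (h₁ : ∀ᵐ x ∂μ, ∀ j, j ≠ y₁ x → f₁ x j < f₁ x (y₁ x))
    (h₂ : ∀ᵐ x ∂μ, ∀ j, j ≠ y₂ x → f₂ x j < f₂ x (y₂ x)) :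
    μ {x | y₁ x ≠ y₂ x} ≤
      μ {x | ∑ j, |f₁ x j - f₂ x j| >
        min (f₁ x (y₁ x) - sndMax hK (f₁ x) (y₁ x))
            (f₂ x (y₂ x) - sndMax hK (f₂ x) (y₂ x))} := by
  refine measure_mono_ae ?_
  filter_upwards [h₂] with x hx hne
  exact min_confidence_lt_l1 hK hne hx
end

section
/- Let p and q be probability vectors on K classes, each with strictly positive entries and a unique largest coordinate, with argmax indices i_p and i_q. If i_p = i_q, then the surrogate churn (1/2)·∑_{j=1}^K |(p_j / p_{i_p})^α − (q_j / q_{i_q})^α| tends to 0 as α → ∞; if i_p ≠ i_q, it tends to 1 as α → ∞. In other words, as α → ∞ the surrogate churn between the two prediction vectors converges to the 0/1 churn indicator 𝟙{argmax p ≠ argmax q}. -/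
open Filter

/-- Powers of the coordinates normalised by a strict maximum converge to its indicator. -/
theorem tendsto_div_rpow_atTop_of_forall_lt {ι : Type*} [DecidableEq ι] {p : ι → ℝ} {i : ι}
    (hpos : ∀ j, 0 < p j) (hmax : ∀ j, j ≠ i → p j < p i) (j : ι) :
    Tendsto (fun α : ℝ => (p j / p i) ^ α) atTop (nhds (if j = i then 1 else 0)) := by
  split_ifs with h
  · subst h
    simp [div_self (hpos j).ne']
  · have hdiv : 0 < p j / p i := div_pos (hpos j) (hpos i)
    exact tendsto_rpow_atTop_of_base_lt_one _ (by linarith)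
      ((div_lt_one (hpos i)).2 (hmax j h))

theorem half_sum_abs_indicator_sub_indicator {ι : Type*} [Fintype ι] [DecidableEq ι] (a b : ι) :
    (1 / 2 : ℝ) * ∑ j, |(if j = a then (1 : ℝ) else 0) - (if j = b then 1 else 0)| =
      if a = b then 0 else 1 := by
  split_ifs with hab
  · simp [hab]
  · have h : ∀ j, |(if j = a then (1 : ℝ) else 0) - (if j = b then 1 else 0)| =
        (if j = a then 1 else 0) + (if j = b then 1 else 0) := by
      intro j
      by_cases ha : j = a
      · simp [ha, hab]
      · by_cases hb : j = b <;> simp [ha, hb, Ne.symm hab]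
    simp only [h, Finset.sum_add_distrib, Finset.sum_ite_eq', Finset.mem_univ, if_true]
    norm_num

/-- Section 2.2: as `α → ∞`, the pointwise surrogate churn
`SChurn_α(p, q) = (1/2) ∑ j, |(p j / max_k p k)^α - (q j / max_k q k)^α|`
between two probability vectors `p, q` (with strictly positive entries and unique
largest coordinates at `ip` and `iq`, so `max_k p k = p ip` and `max_k q k = q iq`)
converges to the 0/1 churn indicator `𝟙{argmax p ≠ argmax q}`: it tends to `0`
if `ip = iq` and to `1` if `ip ≠ iq`. -/
theorem schurn_tendsto_churn {K : ℕ}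
    (p q : Fin K → ℝ)
    (hp0 : ∀ j, 0 < p j) (hq0 : ∀ j, 0 < q j)
    (hps : ∑ j, p j = 1) (hqs : ∑ j, q j = 1)
    (ip iq : Fin K)
    (hip : ∀ j, j ≠ ip → p j < p ip)
    (hiq : ∀ j, j ≠ iq → q j < q iq) :
    Tendsto (fun α : ℝ => (1 / 2) * ∑ j, |(p j / p ip) ^ α - (q j / q iq) ^ α|)
      atTop (nhds (if ip = iq then (0 : ℝ) else 1)) := by
  rw [← half_sum_abs_indicator_sub_indicator ip iq]
  exact (tendsto_finsetSum _ fun j _ =>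
    ((tendsto_div_rpow_atTop_of_forall_lt hp0 hip j).sub
      (tendsto_div_rpow_atTop_of_forall_lt hq0 hiq j)).abs).const_mul _
end

section
/- Let p and q be probability vectors on K classes. Then the total variation-type L1 bound holds for the churn event via union bound: if i_p is the unique argmax of p with confidence γ_p and i_q is the unique argmax of q with confidence γ_q, then the event {i_p ≠ i_q} is contained in the union of the events {∑_j |p_j − q_j| > γ_p} and {∑_j |p_j − q_j| > γ_q}; i.e., i_p ≠ i_q implies ∑_j |p_j − q_j| > γ_p or ∑_j |p_j − q_j| > γ_q. -/
/-- Event inclusion (tv-churn-confidence-3) in the proof of Lemma 2.2: for probability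
vectors `p, q` on `K` classes with unique argmaxes `ip, iq` and prediction confidences
`γ_p = p ip - sndMax p ip`, `γ_q = q iq - sndMax q iq`, if `ip ≠ iq` then
`∑ j, |p j - q j| > γ_p` or `∑ j, |p j - q j| > γ_q`. -/
theorem argmax_ne_imp_l1_gt_confidence {K : ℕ} (hK : 1 < K)
    (p q : Fin K → ℝ)
    (hp0 : ∀ j, 0 ≤ p j) (hq0 : ∀ j, 0 ≤ q j)
    (hps : ∑ j, p j = 1) (hqs : ∑ j, q j = 1)
    (ip iq : Fin K)
    (hip : ∀ j, j ≠ ip → p j < p ip)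
    (hiq : ∀ j, j ≠ iq → q j < q iq)
    (hne : ip ≠ iq) :
    ∑ j, |p j - q j| > p ip - sndMax hK p ip ∨
    ∑ j, |p j - q j| > q iq - sndMax hK q iq := by
  left
  have hsnd : p iq ≤ sndMax hK p ip :=
    Finset.le_sup' p (Finset.mem_erase.mpr ⟨hne.symm, Finset.mem_univ iq⟩)
  have hpair : |p ip - q ip| + |p iq - q iq| ≤ ∑ j, |p j - q j| := by
    rw [← Finset.sum_pair (f := fun j => |p j - q j|) hne]
    exact Finset.sum_le_sum_of_subset_of_nonneg (Finset.subset_univ _)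
      fun j _ _ => abs_nonneg _
  linarith [hiq ip hne, le_abs_self (p ip - q ip), neg_le_abs (p iq - q iq)]
end
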